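/- Let G be a finite simple graph without isolated vertices and let S be a total dominating sequence of G of maximum length (a Grundy total dominating sequence). If S is the concatenation S_1 ⊕ S_2 of two sequences such that the set of vertices of S_1 is a maximal independent set in G, then the length of S_2 equals the length of S_1; in particular γ_gr^t(G) is even. -/

import Mathlib

/-- `s` is a legal (open neighborhood) sequence in `G`. -/
def IsLegalSeq {V : Type*} (G : SimpleGraph V) (s : List V) : Prop :=
  s.Nodup ∧ ∀ i : Fin s.length, ∃ w : V, G.Adj (s.get i) w ∧
    ∀ j : Fin s.length, (j : ℕ) < (i : ℕ) → ¬ G.Adj (s.get j) w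

/-- A total dominating sequence: a legal sequence whose set of entries totally dominates `G`. -/
def IsTotalDomSeq {V : Type*} (G : SimpleGraph V) (s : List V) : Prop :=
  IsLegalSeq G s ∧ ∀ v : V, ∃ u ∈ s, G.Adj u v

/-- The Grundy total domination number: the maximum length of a total dominating sequence. -/
noncomputable def grundyTotal {V : Type*} (G : SimpleGraph V) : ℕ :=
  sSup {n | ∃ s : List V, IsTotalDomSeq G s ∧ s.length = n}

/-- An independent set of `G`. -/
def IsIndepSet {V : Type*} (G : SimpleGraph V) (I : Set V) : Prop :=
  I.Pairwise (fun a b => ¬ G.Adj a b)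

theorem isLegalSeq_iff_getElem {V : Type*} {G : SimpleGraph V} {s : List V} :
    IsLegalSeq G s ↔ s.Nodup ∧ ∀ (i : ℕ) (hi : i < s.length), ∃ w : V, G.Adj s[i] w ∧
      ∀ (j : ℕ) (hj : j < i), ¬ G.Adj s[j] w := by
  refine and_congr_right fun _ => ⟨fun h i hi => ?_, fun h i => ?_⟩
  · obtain ⟨w, hw, hw'⟩ := h ⟨i, hi⟩
    exact ⟨w, hw, fun j hj => hw' ⟨j, hj.trans hi⟩ hj⟩
  · obtain ⟨w, hw, hw'⟩ := h i i.2
    exact ⟨w, hw, fun j hj => hw' j hj⟩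

theorem IsTotalDomSeq.length_le_grundyTotal {V : Type*} [Fintype V] {G : SimpleGraph V}
    {s : List V} (hs : IsTotalDomSeq G s) : s.length ≤ grundyTotal G := by
  refine le_csSup ⟨Fintype.card V, ?_⟩ ⟨s, hs, rfl⟩
  rintro n ⟨t, ht, rfl⟩
  exact ht.1.1.length_le_card

/-- Every vertex outside a maximal independent set has a neighbor in it. -/
theorem IsIndepSet.exists_adj_of_notMem {V : Type*} {G : SimpleGraph V} {I : Set V}
    (hI : IsIndepSet G I) (hmax : ∀ J : Set V, IsIndepSet G J → I ⊆ J → J = I)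
    {v : V} (hv : v ∉ I) : ∃ a ∈ I, G.Adj a v := by
  by_contra! h
  refine hv (hmax (insert v I) ?_ (Set.subset_insert v I) ▸ Set.mem_insert v I)
  exact (Set.pairwise_insert_of_notMem hv).2
    ⟨hI, fun a ha => ⟨fun hva => h a ha hva.symm, h a ha⟩⟩

/-- After a prefix dominating every vertex outside itself, at most as many vertices can follow. -/
theorem IsLegalSeq.length_le_of_prefix_dominates {V : Type*} {G : SimpleGraph V} {s t : List V}
    (h : IsLegalSeq G (s ++ t)) (hdom : ∀ v ∉ s, ∃ a ∈ s, G.Adj a v) :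
    t.length ≤ s.length := by
  classical
  have hw : ∀ i : Fin t.length, ∃ w : V, w ∈ s ∧ G.Adj t[i] w ∧
      ∀ j : Fin t.length, j < i → ¬ G.Adj t[j] w := by
    intro i
    obtain ⟨w, hw, hw'⟩ := (isLegalSeq_iff_getElem.1 h).2 (s.length + i) (by simp)
    refine ⟨w, ?_, by simpa using hw, fun j hj => ?_⟩
    · by_contra hws
      obtain ⟨a, ha, haw⟩ := hdom w hws
      obtain ⟨j, hj, rfl⟩ := List.getElem_of_mem ha
      exact hw' j (by omega) (by simpa [List.getElem_append_left hj] using haw)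
    · simpa using hw' (s.length + j) (by simpa using hj)
  choose f hfs hf hf' using hw
  have hinj : Function.Injective f := by
    intro i j hij
    rcases lt_trichotomy i j with hlt | heq | hlt
    · exact absurd (hij ▸ hf i) (hf' j i hlt)
    · exact heq
    · exact absurd (hij ▸ hf j) (hf' i j hlt)
  calc t.length = (Finset.univ.image f).card := by
        rw [Finset.card_image_of_injective _ hinj, Finset.card_fin]
    _ ≤ s.toFinset.card := Finset.card_le_card (by
        intro x hx
        obtain ⟨i, -, rfl⟩ := Finset.mem_image.1 hx
        exact List.mem_toFinset.2 (hfs i))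
    _ ≤ s.length := s.toFinset_card_le

/-- A legal ordering of a maximal independent set, followed by its footprinted vertices in
reverse order, is a total dominating sequence. -/
theorem IsLegalSeq.exists_isTotalDomSeq_of_indep {V : Type*} {G : SimpleGraph V} {s : List V}
    (h : IsLegalSeq G s) (hind : IsIndepSet G {a | a ∈ s})
    (hdom : ∀ v ∉ s, ∃ a ∈ s, G.Adj a v) :
    ∃ t : List V, t.length = s.length ∧ IsTotalDomSeq G (s ++ t) := by
  have hnadj : ∀ a ∈ s, ∀ b ∈ s, ¬ G.Adj a b := fun a ha b hb hab => hind ha hb hab.ne hab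
  choose f hf hf' using h.2
  have hfs : ∀ i, f i ∉ s := fun i hi => hnadj _ (s.get_mem i) _ hi (hf i)
  have hinj : Function.Injective f := by
    intro i j hij
    rcases lt_trichotomy i j with hlt | heq | hlt
    · exact absurd (hij ▸ hf i) (hf' j i hlt)
    · exact heq
    · exact absurd (hij ▸ hf j) (hf' i j hlt)
  refine ⟨List.ofFn (f ∘ Fin.rev), by simp, isLegalSeq_iff_getElem.2 ⟨?_, ?_⟩, ?_⟩
  · refine List.nodup_append'.2 ⟨h.1, List.nodup_ofFn.2 (hinj.comp Fin.rev_injective), ?_⟩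
    intro a ha hat
    obtain ⟨i, rfl⟩ := List.mem_ofFn.1 hat
    exact hfs _ ha
  · intro i hi
    by_cases his : i < s.length
    · refine ⟨f ⟨i, his⟩, ?_, fun j hj => ?_⟩
      · simpa [List.getElem_append_left his] using hf ⟨i, his⟩
      · simpa [List.getElem_append_left (hj.trans his)] using hf' ⟨i, his⟩ ⟨j, hj.trans his⟩ hj
    · obtain ⟨k, rfl⟩ := Nat.exists_eq_add_of_le (not_lt.1 his)
      have hk : k < s.length := by simpa using hi
      refine ⟨s.get (Fin.rev ⟨k, hk⟩), by simpa using (hf (Fin.rev ⟨k, hk⟩)).symm, fun j hj => ?_⟩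
      by_cases hjs : j < s.length
      · rw [List.getElem_append_left hjs]
        exact hnadj _ (List.getElem_mem hjs) _ (s.get_mem _)
      · obtain ⟨l, rfl⟩ := Nat.exists_eq_add_of_le (not_lt.1 hjs)
        have hlk : l < k := by omega
        have := hf' (Fin.rev ⟨l, hlk.trans hk⟩) (Fin.rev ⟨k, hk⟩)
          (Fin.rev_lt_rev.2 (Fin.mk_lt_mk.2 hlk))
        simpa using fun hadj => this (G.adj_symm hadj)
  · intro v
    by_cases hv : v ∈ s
    · obtain ⟨i, rfl⟩ := List.get_of_mem hv
      exact ⟨f i, List.mem_append_right _ (List.mem_ofFn.2 ⟨i.rev, by simp⟩), (hf i).symm⟩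
    · obtain ⟨a, ha, hav⟩ := hdom v hv
      exact ⟨a, List.mem_append_left _ ha, hav⟩

theorem IsLegalSeq.of_append_left {V : Type*} {G : SimpleGraph V} {s t : List V}
    (h : IsLegalSeq G (s ++ t)) : IsLegalSeq G s := by
  rw [isLegalSeq_iff_getElem] at h ⊢
  refine ⟨h.1.of_append_left, fun i hi => ?_⟩
  obtain ⟨w, hw, hw'⟩ := h.2 i (by simp; omega)
  refine ⟨w, by simpa [List.getElem_append_left hi] using hw, fun j hj => ?_⟩
  simpa [List.getElem_append_left (hj.trans hi)] using hw' j hj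

theorem grundyTotal_even_of_maximal_independent_prefix {V : Type*} [Fintype V]
    (G : SimpleGraph V) (hiso : ∀ v : V, ∃ u : V, G.Adj v u)
    (S₁ S₂ : List V) (hS : IsTotalDomSeq G (S₁ ++ S₂))
    (hmax : (S₁ ++ S₂).length = grundyTotal G)
    (hind : IsIndepSet G {a | a ∈ S₁})
    (hmaxind : ∀ J : Set V, IsIndepSet G J → {a | a ∈ S₁} ⊆ J → J = {a | a ∈ S₁}) :
    S₂.length = S₁.length ∧ Even (grundyTotal G) := by
  have hdom : ∀ v ∉ S₁, ∃ a ∈ S₁, G.Adj a v := fun v hv => hind.exists_adj_of_notMem hmaxind hv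
  have hle := hS.1.length_le_of_prefix_dominates hdom
  obtain ⟨T, hT, hdomT⟩ := hS.1.of_append_left.exists_isTotalDomSeq_of_indep hind hdom
  have hge := hdomT.length_le_grundyTotal
  rw [← hmax, List.length_append, List.length_append, hT] at hge
  have heq : S₂.length = S₁.length := by omega
  exact ⟨heq, S₁.length, by rw [← hmax, List.length_append, heq]⟩
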